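/- Let X be a sub-Gaussian random vector in ℝ^d whose function A(h) = |h|²/2 − log E exp(⟨h,X⟩) satisfies A(h) ≥ 0 for all h ∈ ℝ^d. Then for all x, h ∈ ℝ^d: |A(h + x) − A(h)| ≤ √(2A(h)) · |x| + |x|²/2. -/

import Mathlib

open MeasureTheory ProbabilityTheory Real Filter
open scoped ENNReal RealInnerProductSpace Topology

/-- A probability distribution on `ℝ^d` is sub-Gaussian if `E exp(c|X|²) < ∞` for some `c > 0`. -/
def IsSubGaussian {d : ℕ} (μ : Measure (EuclideanSpace ℝ (Fin d))) : Prop :=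
  ∃ c > 0, Integrable (fun x => Real.exp (c * ‖x‖ ^ 2)) μ

/-- The log-Laplace transform `K(t) = log ∫ e^{⟨t,x⟩} dμ(x)`. -/
noncomputable def Kfun {d : ℕ} (μ : Measure (EuclideanSpace ℝ (Fin d)))
    (t : EuclideanSpace ℝ (Fin d)) : ℝ :=
  Real.log (∫ x, Real.exp ⟪t, x⟫ ∂μ)

/-- The function `A(t) = |t|²/2 - K(t)`. -/
noncomputable def Afun {d : ℕ} (μ : Measure (EuclideanSpace ℝ (Fin d)))
    (t : EuclideanSpace ℝ (Fin d)) : ℝ :=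
  ‖t‖ ^ 2 / 2 - Kfun μ t

lemma IsSubGaussian.integrable_exp_inner {d : ℕ} {μ : Measure (EuclideanSpace ℝ (Fin d))}
    [IsProbabilityMeasure μ] (hsub : IsSubGaussian μ) (t : EuclideanSpace ℝ (Fin d)) :
    Integrable (fun x => Real.exp ⟪t, x⟫) μ := by
  obtain ⟨c, hc, hint⟩ := hsub
  refine (hint.const_mul (Real.exp (‖t‖ ^ 2 / (4 * c)))).mono' (by fun_prop)
    (ae_of_all _ fun x => ?_)
  rw [Real.norm_eq_abs, Real.abs_exp, ← Real.exp_add, Real.exp_le_exp]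
  have hsq : ‖t‖ ^ 2 / (4 * c) + c * ‖x‖ ^ 2 - ‖t‖ * ‖x‖ = (‖t‖ - 2 * c * ‖x‖) ^ 2 / (4 * c) := by
    field_simp
    ring
  have hnonneg : 0 ≤ (‖t‖ - 2 * c * ‖x‖) ^ 2 / (4 * c) := by positivity
  linarith [real_inner_le_norm t x]

lemma exp_Kfun {d : ℕ} {μ : Measure (EuclideanSpace ℝ (Fin d))}
    [IsProbabilityMeasure μ] (hsub : IsSubGaussian μ) (t : EuclideanSpace ℝ (Fin d)) :
    Real.exp (Kfun μ t) = ∫ x, Real.exp ⟪t, x⟫ ∂μ :=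
  Real.exp_log (integral_exp_pos (hsub.integrable_exp_inner t))

/-- The log-Laplace transform is convex. -/
lemma convexOn_Kfun {d : ℕ} {μ : Measure (EuclideanSpace ℝ (Fin d))}
    [IsProbabilityMeasure μ] (hsub : IsSubGaussian μ) :
    ConvexOn ℝ Set.univ (Kfun μ) := by
  refine ⟨convex_univ, fun p _ q _ a b ha hb hab => ?_⟩
  have hnormalized (t : EuclideanSpace ℝ (Fin d)) :
      ∫ x, Real.exp (-Kfun μ t) * Real.exp ⟪t, x⟫ ∂μ = 1 := by
    rw [integral_const_mul, ← exp_Kfun hsub, ← Real.exp_add, neg_add_cancel, Real.exp_zero]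
  have hint (t : EuclideanSpace ℝ (Fin d)) (r : ℝ) :
      Integrable (fun x => r * Real.exp ⟪t, x⟫) μ :=
    (hsub.integrable_exp_inner t).const_mul r
  have hle : ∫ x, Real.exp (-(a * Kfun μ p + b * Kfun μ q)) * Real.exp ⟪a • p + b • q, x⟫ ∂μ ≤
      ∫ x, (a * (Real.exp (-Kfun μ p) * Real.exp ⟪p, x⟫) +
        b * (Real.exp (-Kfun μ q) * Real.exp ⟪q, x⟫)) ∂μ := by
    refine integral_mono (hint _ _) (((hint p _).const_mul a).add ((hint q _).const_mul b))
      fun x => ?_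
    have hconv := convexOn_exp.2 (Set.mem_univ (-Kfun μ p + ⟪p, x⟫))
      (Set.mem_univ (-Kfun μ q + ⟪q, x⟫)) ha hb hab
    simp only [smul_eq_mul] at hconv
    simp only [← Real.exp_add, inner_add_left, real_inner_smul_left]
    convert hconv using 2
    ring
  rw [integral_add ((hint p _).const_mul a) ((hint q _).const_mul b), integral_const_mul,
    integral_const_mul a, integral_const_mul b, hnormalized, hnormalized, mul_one, mul_one, hab,
    ← exp_Kfun hsub, ← Real.exp_add, Real.exp_le_one_iff] at hle
  simp only [smul_eq_mul]
  linarith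

lemma Afun_add_le_of_pos {d : ℕ} {μ : Measure (EuclideanSpace ℝ (Fin d))}
    [IsProbabilityMeasure μ] (hsub : IsSubGaussian μ) (hA : ∀ h, 0 ≤ Afun μ h)
    (x h : EuclideanSpace ℝ (Fin d)) {u : ℝ} (hu : 0 < u) :
    Afun μ (h + x) ≤ Afun μ h + Afun μ h / u + (1 + u) * ‖x‖ ^ 2 / 2 := by
  have hconv := (convexOn_Kfun hsub).2 (Set.mem_univ (h + x)) (Set.mem_univ (h - u • x))
    (by positivity : 0 ≤ u / (1 + u)) (by positivity : 0 ≤ 1 / (1 + u)) (by field_simp; ring)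
  have hpoint : (u / (1 + u)) • (h + x) + (1 / (1 + u)) • (h - u • x) = h := by
    match_scalars <;> field_simp <;> ring
  rw [hpoint, smul_eq_mul, smul_eq_mul] at hconv
  have hK : (1 + u) * Kfun μ h ≤ u * Kfun μ (h + x) + Kfun μ (h - u • x) := by
    refine (mul_le_mul_of_nonneg_left hconv (by positivity : 0 ≤ 1 + u)).trans_eq ?_
    field_simp
  have hback := hA (h - u • x)
  have hadd := norm_add_sq_real h x
  have hsub_norm := norm_sub_sq_real h (u • x)
  rw [real_inner_smul_right, norm_smul, Real.norm_of_nonneg hu.le] at hsub_norm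
  have hscaled : u * Afun μ (h + x) ≤ u * Afun μ h + Afun μ h + u * ((1 + u) * ‖x‖ ^ 2 / 2) := by
    unfold Afun at hback ⊢
    rw [hsub_norm] at hback
    rw [hadd]
    nlinarith
  refine le_of_mul_le_mul_left (hscaled.trans_eq ?_) hu
  field_simp

lemma Afun_add_le {d : ℕ} {μ : Measure (EuclideanSpace ℝ (Fin d))}
    [IsProbabilityMeasure μ] (hsub : IsSubGaussian μ) (hA : ∀ h, 0 ≤ Afun μ h)
    (x h : EuclideanSpace ℝ (Fin d)) :
    Afun μ (h + x) ≤ Afun μ h + Real.sqrt (2 * Afun μ h) * ‖x‖ + ‖x‖ ^ 2 / 2 := by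
  have hsq : Real.sqrt (2 * Afun μ h) ^ 2 = 2 * Afun μ h := Real.sq_sqrt (by linarith [hA h])
  rcases eq_or_ne x 0 with rfl | hx
  · simp
  have hx' : 0 < ‖x‖ := norm_pos_iff.2 hx
  rcases (Real.sqrt_nonneg (2 * Afun μ h)).eq_or_lt with hs | hs
  · have hzero : Afun μ h = 0 := by rw [← hs] at hsq; linarith
    refine le_of_forall_pos_le_add fun ε hε => ?_
    have hle := Afun_add_le_of_pos hsub hA x h (u := 2 * ε / ‖x‖ ^ 2) (by positivity)
    have heq : (1 + 2 * ε / ‖x‖ ^ 2) * ‖x‖ ^ 2 / 2 = ‖x‖ ^ 2 / 2 + ε := by field_simp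
    rw [heq, hzero, zero_div] at hle
    rw [← hs, hzero]
    linarith
  · refine (Afun_add_le_of_pos hsub hA x h (div_pos hs hx')).trans_eq ?_
    have hhalf : Afun μ h = Real.sqrt (2 * Afun μ h) ^ 2 / 2 := by linarith
    generalize Real.sqrt (2 * Afun μ h) = s at *
    rw [hhalf]
    field_simp
    ring

theorem stmt8 {d : ℕ} (hd : 1 ≤ d)
    (μ : Measure (EuclideanSpace ℝ (Fin d))) [IsProbabilityMeasure μ]
    (hsub : IsSubGaussian μ)
    (hA : ∀ h, 0 ≤ Afun μ h)
    (x h : EuclideanSpace ℝ (Fin d)) :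
    |Afun μ (h + x) - Afun μ h| ≤ Real.sqrt (2 * Afun μ h) * ‖x‖ + ‖x‖ ^ 2 / 2 := by
  have hupper := Afun_add_le hsub hA x h
  have hlower := Afun_add_le hsub hA (-x) (h + x)
  rw [add_neg_cancel_right, norm_neg] at hlower
  have hs := Real.sq_sqrt (by linarith [hA h] : 0 ≤ 2 * Afun μ h)
  have hr := Real.sq_sqrt (by linarith [hA (h + x)] : 0 ≤ 2 * Afun μ (h + x))
  have hs0 := Real.sqrt_nonneg (2 * Afun μ h)
  have hr0 := Real.sqrt_nonneg (2 * Afun μ (h + x))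
  have hsr : Real.sqrt (2 * Afun μ h) ≤ Real.sqrt (2 * Afun μ (h + x)) + ‖x‖ :=
    (sq_le_sq₀ hs0 (by positivity)).1 (by nlinarith)
  rw [abs_le]
  refine ⟨?_, by linarith⟩
  rcases le_total ‖x‖ (Real.sqrt (2 * Afun μ h)) with hx | hx
  · nlinarith [mul_self_le_mul_self (sub_nonneg.2 hx) (sub_le_iff_le_add.2 hsr), sq_nonneg ‖x‖]
  · nlinarith [mul_self_le_mul_self hs0 hx, mul_nonneg hs0 (norm_nonneg x)]
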